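/- The system dW/dx = A(x)W has a strong regular fundamental solution at x₀ if and only if γ₋₂(α₀ − β₀) = γ₋₁. -/

import Mathlib

open Metric Set Filter Topology

section PowerSeries

variable {E : Type*} [NormedAddCommGroup E]

theorem summable_norm_of_coeff_bound {a : ℕ → E} {ρ : ℝ}
    (ha : ∀ r, 0 < r → r < ρ → ∃ C, ∀ k, ‖a k‖ * r ^ k ≤ C) {s : ℝ} (hs0 : 0 ≤ s) (hs : s < ρ) :
    Summable (fun k : ℕ => (k + 1 : ℝ) * (‖a k‖ * s ^ k)) := by
  obtain ⟨r, hsr, hr⟩ := exists_between hs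
  have hr0 : 0 < r := hs0.trans_lt hsr
  obtain ⟨C, hC⟩ := ha r hr0 hr
  have hq : ‖s / r‖ < 1 := by
    rw [Real.norm_of_nonneg (by positivity), div_lt_one hr0]
    exact hsr
  have h1 := summable_pow_mul_geometric_of_norm_lt_one 1 hq
  have h0 := summable_geometric_of_norm_lt_one hq
  refine Summable.of_nonneg_of_le (fun k => by positivity) (fun k => ?_) ((h1.add h0).mul_left C)
  have hk : s ^ k = r ^ k * (s / r) ^ k := by
    rw [← mul_pow, mul_div_cancel₀ _ hr0.ne']
  calc (k + 1 : ℝ) * (‖a k‖ * s ^ k)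
      = (‖a k‖ * r ^ k) * ((k + 1 : ℝ) * (s / r) ^ k) := by rw [hk]; ring
    _ ≤ C * ((k + 1 : ℝ) * (s / r) ^ k) := by gcongr; exact hC k
    _ = C * ((k : ℝ) ^ 1 * (s / r) ^ k + (s / r) ^ k) := by ring

variable [NormedSpace ℂ E]

theorem summable_norm_pow_smul_of_coeff_bound {a : ℕ → E} {ρ : ℝ}
    (ha : ∀ r, 0 < r → r < ρ → ∃ C, ∀ k, ‖a k‖ * r ^ k ≤ C) {t : ℂ} (ht : ‖t‖ < ρ) :
    Summable (fun k : ℕ => ‖t ^ k • a k‖) := by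
  refine Summable.of_nonneg_of_le (fun k => by positivity) (fun k => ?_)
    (summable_norm_of_coeff_bound ha (norm_nonneg t) ht)
  rw [norm_smul, norm_pow, mul_comm]
  exact le_mul_of_one_le_left (by positivity) (by linarith [(Nat.cast_nonneg k : (0 : ℝ) ≤ k)])

theorem coeff_bound_of_summable {a : ℕ → E} {ρ : ℝ}
    (h : ∀ r : ℝ, 0 < r → r < ρ → Summable (fun k : ℕ => (r : ℂ) ^ k • a k)) :
    ∀ r, 0 < r → r < ρ → ∃ C, ∀ k, ‖a k‖ * r ^ k ≤ C := by
  intro r hr0 hr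
  obtain ⟨C, hC⟩ := (h r hr0 hr).tendsto_atTop_zero.norm.bddAbove_range
  refine ⟨C, fun k => ?_⟩
  have := hC (mem_range_self k)
  rwa [norm_smul, norm_pow, Complex.norm_real, Real.norm_of_nonneg hr0.le, mul_comm] at this

theorem hasDerivAt_tsum_pow_smul [CompleteSpace E] {a : ℕ → E} {ρ : ℝ}
    (ha : ∀ r, 0 < r → r < ρ → ∃ C, ∀ k, ‖a k‖ * r ^ k ≤ C) {t : ℂ} (ht : ‖t‖ < ρ) :
    HasDerivAt (fun z : ℂ => ∑' k : ℕ, z ^ k • a k)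
      (∑' k : ℕ, t ^ k • ((k + 1 : ℂ) • a (k + 1))) t := by
  obtain ⟨s, hts, hs⟩ := exists_between ht
  have hs0 : 0 < s := (norm_nonneg t).trans_lt hts
  have hsum : Summable (fun k : ℕ => s⁻¹ * ((k + 1 : ℝ) * (‖a k‖ * s ^ k))) :=
    (summable_norm_of_coeff_bound ha hs0.le hs).mul_left _
  have htb : t ∈ ball (0 : ℂ) s := by simpa using hts
  have hle : ∀ (k : ℕ), ∀ y ∈ ball (0 : ℂ) s,
      ‖((k : ℂ) * y ^ (k - 1)) • a k‖ ≤ s⁻¹ * ((k + 1 : ℝ) * (‖a k‖ * s ^ k)) := by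
    intro k y hy
    have hy' : ‖y‖ ≤ s := by simpa using (mem_ball.mp hy).le
    rcases k with _ | k
    · simp only [CharP.cast_eq_zero, zero_mul, zero_smul, norm_zero]
      positivity
    · rw [norm_smul, norm_mul, norm_pow, Complex.norm_natCast]
      calc ((k + 1 : ℕ) : ℝ) * ‖y‖ ^ (k + 1 - 1) * ‖a (k + 1)‖
          ≤ (((k + 1 : ℕ) : ℝ) + 1) * s ^ k * ‖a (k + 1)‖ := by
            simp only [Nat.add_sub_cancel]
            gcongr
            linarith
        _ = _ := by
            field_simp
            ring
  have hd := hasDerivAt_tsum_of_isPreconnected (g := fun (k : ℕ) (z : ℂ) => z ^ k • a k)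
    (g' := fun (k : ℕ) (z : ℂ) => ((k : ℂ) * z ^ (k - 1)) • a k) hsum isOpen_ball
    (convex_ball (0 : ℂ) s).isPreconnected
    (fun k y _ => (hasDerivAt_pow k y).smul_const (a k)) hle htb
    (summable_norm_pow_smul_of_coeff_bound ha ht).of_norm htb
  have hs1 : Summable (fun k : ℕ => ((k : ℂ) * t ^ (k - 1)) • a k) :=
    (Summable.of_nonneg_of_le (fun k => norm_nonneg _) (fun k => hle k t htb) hsum).of_norm
  convert hd using 1
  rw [hs1.tsum_eq_zero_add]
  simp only [CharP.cast_eq_zero, zero_mul, zero_smul, zero_add]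
  refine tsum_congr fun k => ?_
  rw [smul_smul, mul_comm]
  simp

end PowerSeries

section LinearODE

variable {R : Type*} [NormedRing R] [NormedAlgebra ℂ R]

/-- Coefficients of the formal power series solution `Y` of `Y' = B Y`, `Y 0 = 1`, where `B` has
coefficients `b`. -/
noncomputable def linearODECoeff (b : ℕ → R) : ℕ → R
  | 0 => 1
  | n + 1 => ((n : ℂ) + 1)⁻¹ • ∑ k ∈ Finset.range (n + 1), b k * linearODECoeff b (n - k)
  decreasing_by omega

theorem linearODECoeff_succ (b : ℕ → R) (n : ℕ) :
    ((n : ℂ) + 1) • linearODECoeff b (n + 1) =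
      ∑ k ∈ Finset.range (n + 1), b k * linearODECoeff b (n - k) := by
  rw [linearODECoeff, smul_inv_smul₀]
  exact_mod_cast Nat.succ_ne_zero n

theorem linearODECoeff_sum_le {b : ℕ → R} {r C : ℝ} {N : ℕ} (hr : 0 < r)
    (hC : ∀ k, ‖b k‖ * r ^ k ≤ C) (hN : C * r ≤ N) (n : ℕ) :
    ∑ k ∈ Finset.range (n + 1), ‖linearODECoeff b k‖ * r ^ k ≤ ‖(1 : R)‖ * ((n : ℝ) + 1) ^ N := by
  induction n with
  | zero => simp [linearODECoeff]
  | succ n ih =>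
    set S := ∑ k ∈ Finset.range (n + 1), ‖linearODECoeff b k‖ * r ^ k with hS
    have hS0 : 0 ≤ S := Finset.sum_nonneg fun k _ => by positivity
    have hn : (0 : ℝ) < (n : ℝ) + 1 := by positivity
    have key : ((n : ℝ) + 1) * (‖linearODECoeff b (n + 1)‖ * r ^ (n + 1)) ≤ N * S := by
      have h1 : ((n : ℝ) + 1) * ‖linearODECoeff b (n + 1)‖ ≤
          ∑ k ∈ Finset.range (n + 1), ‖b k‖ * ‖linearODECoeff b (n - k)‖ := by
        have hc : ‖((n : ℂ) + 1)‖ = (n : ℝ) + 1 := by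
          exact_mod_cast Complex.norm_natCast (n + 1)
        rw [← hc, ← norm_smul, linearODECoeff_succ]
        exact (norm_sum_le _ _).trans (Finset.sum_le_sum fun k _ => norm_mul_le _ _)
      calc ((n : ℝ) + 1) * (‖linearODECoeff b (n + 1)‖ * r ^ (n + 1))
          = (((n : ℝ) + 1) * ‖linearODECoeff b (n + 1)‖) * r ^ (n + 1) := by ring
        _ ≤ (∑ k ∈ Finset.range (n + 1), ‖b k‖ * ‖linearODECoeff b (n - k)‖) * r ^ (n + 1) := by
            gcongr
        _ = ∑ k ∈ Finset.range (n + 1),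
              r * ((‖b k‖ * r ^ k) * (‖linearODECoeff b (n - k)‖ * r ^ (n - k))) := by
            rw [Finset.sum_mul]
            refine Finset.sum_congr rfl fun k hk => ?_
            have hkn : k + (n - k) = n := by
              have := Finset.mem_range.mp hk
              omega
            have hpow : r ^ (n + 1) = r ^ k * r ^ (n - k) * r := by
              rw [← pow_add, hkn, pow_succ]
            rw [hpow]
            ring
        _ ≤ ∑ k ∈ Finset.range (n + 1),
              r * (C * (‖linearODECoeff b (n - k)‖ * r ^ (n - k))) := by
            gcongr with k
            exact hC k
        _ = C * r * S := by
            rw [hS, ← Finset.sum_range_reflect (fun k => ‖linearODECoeff b k‖ * r ^ k), Finset.mul_sum]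
            refine Finset.sum_congr rfl fun k _ => ?_
            rw [Nat.add_sub_cancel]
            ring
        _ ≤ N * S := by gcongr
    have hb : 1 + (N : ℝ) * ((n : ℝ) + 1)⁻¹ ≤ (1 + ((n : ℝ) + 1)⁻¹) ^ N :=
      one_add_mul_le_pow (by have : 0 ≤ ((n : ℝ) + 1)⁻¹ := by positivity
                             linarith) N
    rw [Finset.sum_range_succ, ← hS]
    calc S + ‖linearODECoeff b (n + 1)‖ * r ^ (n + 1)
        ≤ S + N * S / ((n : ℝ) + 1) := by
          gcongr
          rw [le_div_iff₀ hn]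
          linarith
      _ = (1 + (N : ℝ) * ((n : ℝ) + 1)⁻¹) * S := by field_simp
      _ ≤ (1 + ((n : ℝ) + 1)⁻¹) ^ N * (‖(1 : R)‖ * ((n : ℝ) + 1) ^ N) := by gcongr
      _ = ‖(1 : R)‖ * ((1 + ((n : ℝ) + 1)⁻¹) * ((n : ℝ) + 1)) ^ N := by rw [mul_pow]; ring
      _ = ‖(1 : R)‖ * (((n + 1 : ℕ) : ℝ) + 1) ^ N := by
          congr 2
          push_cast
          field_simp

theorem linearODECoeff_bound {b : ℕ → R} {ρ : ℝ}
    (hb : ∀ r, 0 < r → r < ρ → ∃ C, ∀ k, ‖b k‖ * r ^ k ≤ C) :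
    ∀ r, 0 < r → r < ρ → ∃ C, ∀ k, ‖linearODECoeff b k‖ * r ^ k ≤ C := by
  intro r hr0 hr
  obtain ⟨s, hrs, hs⟩ := exists_between hr
  have hs0 : 0 < s := hr0.trans hrs
  obtain ⟨C, hC⟩ := hb s hs0 hs
  obtain ⟨N, hN⟩ := exists_nat_ge (C * s)
  have hq : ‖r / s‖ < 1 := by
    rw [Real.norm_of_nonneg (by positivity), div_lt_one hs0]
    exact hrs
  obtain ⟨K, hK⟩ :=
    (summable_pow_mul_geometric_of_norm_lt_one N hq).tendsto_atTop_zero.bddAbove_range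
  refine ⟨‖(1 : R)‖ * (K * (s / r)), fun k => ?_⟩
  have h1 : ‖linearODECoeff b k‖ * s ^ k ≤ ‖(1 : R)‖ * ((k : ℝ) + 1) ^ N := by
    refine le_trans ?_ (linearODECoeff_sum_le hs0 hC hN k)
    exact Finset.single_le_sum (f := fun j => ‖linearODECoeff b j‖ * s ^ j)
      (fun j _ => by positivity) (Finset.self_mem_range_succ k)
  have h2 : ((k + 1 : ℕ) : ℝ) ^ N * (r / s) ^ (k + 1) ≤ K :=
    hK (mem_range_self (k + 1))
  have hk : r ^ k = s ^ k * ((r / s) ^ (k + 1) * (s / r)) := by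
    rw [pow_succ, div_pow]
    field_simp
  calc ‖linearODECoeff b k‖ * r ^ k
      = (‖linearODECoeff b k‖ * s ^ k) * ((r / s) ^ (k + 1) * (s / r)) := by rw [hk]; ring
    _ ≤ (‖(1 : R)‖ * ((k : ℝ) + 1) ^ N) * ((r / s) ^ (k + 1) * (s / r)) := by gcongr
    _ = ‖(1 : R)‖ * ((((k + 1 : ℕ) : ℝ) ^ N * (r / s) ^ (k + 1)) * (s / r)) := by push_cast; ring
    _ ≤ ‖(1 : R)‖ * (K * (s / r)) := by gcongr

/-- A linear ODE with holomorphic coefficients on a disc has a holomorphic solution on the whole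
disc, normalised at the centre. -/
theorem exists_linearODE_solution [CompleteSpace R] {B : ℂ → R} {c : ℂ} {ρ : ℝ}
    (hB : DifferentiableOn ℂ B (ball c ρ)) :
    ∃ Y : ℂ → R, Y c = 1 ∧ ∀ x ∈ ball c ρ, HasDerivAt Y (B x * Y x) x := by
  set b : ℕ → R := fun k => ((k.factorial : ℂ))⁻¹ • iteratedDeriv k B c with hb
  have hsum : ∀ z ∈ ball c ρ, HasSum (fun k => (z - c) ^ k • b k) (B z) := by
    intro z hz
    have h := Complex.hasSum_taylorSeries_on_ball hB hz
    have hfun : (fun k : ℕ => ((k.factorial : ℂ))⁻¹ • (z - c) ^ k • iteratedDeriv k B c) =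
        fun k => (z - c) ^ k • b k :=
      funext fun k => smul_comm ((k.factorial : ℂ))⁻¹ ((z - c) ^ k) (iteratedDeriv k B c)
    rwa [hfun] at h
  have hbb : ∀ r, 0 < r → r < ρ → ∃ C, ∀ k, ‖b k‖ * r ^ k ≤ C := by
    refine coeff_bound_of_summable fun r hr0 hr => ?_
    have hz : c + (r : ℂ) ∈ ball c ρ := by
      simpa [abs_of_pos hr0] using hr
    simpa using (hsum _ hz).summable
  have hYb := linearODECoeff_bound hbb
  refine ⟨fun x => ∑' k : ℕ, (x - c) ^ k • linearODECoeff b k, ?_, fun x hx => ?_⟩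
  · simp only [sub_self]
    rw [tsum_eq_single 0 (fun k hk => by simp [hk])]
    simp [linearODECoeff]
  · have ht : ‖x - c‖ < ρ := by simpa [dist_eq_norm] using hx
    have hd := (hasDerivAt_tsum_pow_smul hYb ht).comp_sub_const x c
    refine hd.congr_deriv ?_
    symm
    rw [← (hsum x hx).tsum_eq, tsum_mul_tsum_eq_tsum_sum_range_of_summable_norm
      (summable_norm_pow_smul_of_coeff_bound hbb ht) (summable_norm_pow_smul_of_coeff_bound hYb ht)]
    refine tsum_congr fun n => ?_
    rw [linearODECoeff_succ, Finset.smul_sum]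
    refine Finset.sum_congr rfl fun k hk => ?_
    have hkn : k + (n - k) = n := by
      have := Finset.mem_range.mp hk
      omega
    rw [smul_mul_smul_comm, ← pow_add, hkn]

end LinearODE

section Planar

variable {c : ℂ} {ρ : ℝ}

theorem eqOn_ball_of_eq_punctured {f g : ℂ → ℂ} (hf : ContinuousOn f (ball c ρ))
    (hg : ContinuousOn g (ball c ρ)) (h : ∀ x ∈ ball c ρ, x ≠ c → f x = g x) :
    ∀ x ∈ ball c ρ, f x = g x := by
  intro x hx
  by_cases hxc : x = c
  · subst hxc
    have hn : ball x ρ ∈ 𝓝 x := isOpen_ball.mem_nhds hx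
    have hft : Tendsto f (𝓝[≠] x) (𝓝 (f x)) := (hf.continuousAt hn).tendsto.mono_left inf_le_left
    have hgt : Tendsto g (𝓝[≠] x) (𝓝 (g x)) := (hg.continuousAt hn).tendsto.mono_left inf_le_left
    refine tendsto_nhds_unique_of_eventuallyEq hft hgt ?_
    filter_upwards [mem_nhdsWithin_of_mem_nhds hn, self_mem_nhdsWithin] with y hy hyx
    exact h y hy hyx
  · exact h x hx hxc

theorem eventually_mem_punctured_ball {x : ℂ} (hx : x ∈ ball c ρ) (hxc : x ≠ c) :
    ∀ᶠ y in 𝓝 x, y ∈ ball c ρ ∧ y ≠ c :=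
  (isOpen_ball.eventually_mem hx).and (isOpen_ne.eventually_mem hxc)

/-- A holomorphic function on a disc satisfying `d' = τ d` off the centre is nowhere zero unless it
vanishes everywhere. -/
theorem eq_zero_iff_of_deriv_eq_mul {d τ : ℂ → ℂ} (hd : DifferentiableOn ℂ d (ball c ρ))
    (hτ : DifferentiableOn ℂ τ (ball c ρ))
    (h : ∀ x ∈ ball c ρ, x ≠ c → HasDerivAt d (τ x * d x) x) {x y : ℂ} (hx : x ∈ ball c ρ)
    (hy : y ∈ ball c ρ) : d x = 0 ↔ d y = 0 := by
  obtain ⟨P, hP⟩ := hτ.isExactOn_ball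
  have hder : ∀ z ∈ ball c ρ, deriv d z = τ z * d z :=
    eqOn_ball_of_eq_punctured (hd.deriv isOpen_ball).continuousOn
      (hτ.mul hd).continuousOn fun z hz hzc => (h z hz hzc).deriv
  have hE : ∀ z ∈ ball c ρ, HasDerivAt (fun z => d z * Complex.exp (-P z)) 0 z := by
    intro z hz
    have h1 := (hd.differentiableAt (isOpen_ball.mem_nhds hz)).hasDerivAt
    rw [hder z hz] at h1
    refine (h1.mul (hP z hz).neg.cexp).congr_deriv ?_
    ring
  have hconst : d x * Complex.exp (-P x) = d y * Complex.exp (-P y) :=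
    isOpen_ball.is_const_of_deriv_eq_zero (convex_ball c ρ).isPreconnected
      (fun z hz => (hE z hz).differentiableAt.differentiableWithinAt)
      (fun z hz => (hE z hz).deriv) hx hy
  constructor <;> intro h0 <;> rw [h0] at hconst <;> simpa [Complex.exp_ne_zero] using hconst

/-- A solution, meromorphic at `c`, of a planar system with a simple pole at `c` and nilpotent
residue is holomorphic, and its value at `c` lies in the kernel of the residue. -/
theorem exists_holomorphic_extension {p q r s y₁ y₂ : ℂ → ℂ} {κ : ℂ} (hρ : 0 < ρ)
    (hp : DifferentiableOn ℂ p (ball c ρ)) (hq : DifferentiableOn ℂ q (ball c ρ))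
    (hr : DifferentiableOn ℂ r (ball c ρ)) (hs : DifferentiableOn ℂ s (ball c ρ))
    (h₁ : ∀ x ∈ ball c ρ, x ≠ c → HasDerivAt y₁ (p x * y₁ x + q x * y₂ x) x)
    (h₂ : ∀ x ∈ ball c ρ, x ≠ c →
      HasDerivAt y₂ ((κ / (x - c) + r x) * y₁ x + s x * y₂ x) x)
    (n : ℕ) {v₁ v₂ : ℂ → ℂ} (hv₁ : DifferentiableOn ℂ v₁ (ball c ρ))
    (hv₂ : DifferentiableOn ℂ v₂ (ball c ρ))
    (hyv₁ : ∀ x ∈ ball c ρ, x ≠ c → (x - c) ^ n * y₁ x = v₁ x)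
    (hyv₂ : ∀ x ∈ ball c ρ, x ≠ c → (x - c) ^ n * y₂ x = v₂ x) :
    ∃ u₁ u₂ : ℂ → ℂ, DifferentiableOn ℂ u₁ (ball c ρ) ∧ DifferentiableOn ℂ u₂ (ball c ρ) ∧
      (∀ x ∈ ball c ρ, x ≠ c → y₁ x = u₁ x) ∧ (∀ x ∈ ball c ρ, x ≠ c → y₂ x = u₂ x) ∧
      κ * u₁ c = 0 := by
  have hc : c ∈ ball c ρ := mem_ball_self hρ
  have hid : DifferentiableOn ℂ (fun x => x - c) (ball c ρ) := by fun_prop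
  induction n generalizing v₁ v₂ with
  | zero =>
    refine ⟨v₁, v₂, hv₁, hv₂, by simpa using hyv₁, by simpa using hyv₂, ?_⟩
    have key : ∀ x ∈ ball c ρ, (x - c) * deriv v₂ x =
        κ * v₁ x + (x - c) * (r x * v₁ x + s x * v₂ x) := by
      refine eqOn_ball_of_eq_punctured (hid.mul (hv₂.deriv isOpen_ball)).continuousOn
        (((differentiableOn_const κ).mul hv₁).add
          (hid.mul ((hr.mul hv₁).add (hs.mul hv₂)))).continuousOn fun x hx hxc => ?_
      have hxc' : x - c ≠ 0 := sub_ne_zero.mpr hxc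
      have he : v₂ =ᶠ[𝓝 x] y₂ := by
        filter_upwards [eventually_mem_punctured_ball hx hxc] with z hz
        rw [← hyv₂ z hz.1 hz.2, pow_zero, one_mul]
      rw [((h₂ x hx hxc).congr_of_eventuallyEq he).deriv, ← hyv₁ x hx hxc, ← hyv₂ x hx hxc]
      field_simp
      ring
    simpa using (key c hc).symm
  | succ n ih =>
    have hn : (n : ℂ) + 1 ≠ 0 := Nat.cast_add_one_ne_zero n
    have hpow : ∀ x, HasDerivAt (fun z : ℂ => (z - c) ^ (n + 1)) (((n : ℂ) + 1) * (x - c) ^ n) x := by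
      intro x
      simpa using ((hasDerivAt_id x).sub_const c).fun_pow (n + 1)
    have key₁ : ∀ x ∈ ball c ρ, (x - c) * deriv v₁ x =
        ((n : ℂ) + 1) * v₁ x + (x - c) * (p x * v₁ x + q x * v₂ x) := by
      refine eqOn_ball_of_eq_punctured (hid.mul (hv₁.deriv isOpen_ball)).continuousOn
        (((differentiableOn_const _).mul hv₁).add
          (hid.mul ((hp.mul hv₁).add (hq.mul hv₂)))).continuousOn fun x hx hxc => ?_
      have he : v₁ =ᶠ[𝓝 x] fun z => (z - c) ^ (n + 1) * y₁ z := by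
        filter_upwards [eventually_mem_punctured_ball hx hxc] with z hz
        rw [← hyv₁ z hz.1 hz.2]
      rw [(((hpow x).mul (h₁ x hx hxc)).congr_of_eventuallyEq he).deriv, ← hyv₁ x hx hxc,
        ← hyv₂ x hx hxc]
      ring
    have key₂ : ∀ x ∈ ball c ρ, (x - c) * deriv v₂ x =
        ((n : ℂ) + 1) * v₂ x + κ * v₁ x + (x - c) * (r x * v₁ x + s x * v₂ x) := by
      refine eqOn_ball_of_eq_punctured (hid.mul (hv₂.deriv isOpen_ball)).continuousOn
        ((((differentiableOn_const _).mul hv₂).add ((differentiableOn_const κ).mul hv₁)).add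
          (hid.mul ((hr.mul hv₁).add (hs.mul hv₂)))).continuousOn fun x hx hxc => ?_
      have hxc' : x - c ≠ 0 := sub_ne_zero.mpr hxc
      have he : v₂ =ᶠ[𝓝 x] fun z => (z - c) ^ (n + 1) * y₂ z := by
        filter_upwards [eventually_mem_punctured_ball hx hxc] with z hz
        rw [← hyv₂ z hz.1 hz.2]
      rw [(((hpow x).mul (h₂ x hx hxc)).congr_of_eventuallyEq he).deriv, ← hyv₁ x hx hxc,
        ← hyv₂ x hx hxc]
      field_simp
      ring
    have hv₁c : v₁ c = 0 := by simpa [hn] using (key₁ c hc).symm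
    have hv₂c : v₂ c = 0 := by simpa [hn, hv₁c] using (key₂ c hc).symm
    have hdiv : ∀ {v y : ℂ → ℂ}, v c = 0 →
        (∀ x ∈ ball c ρ, x ≠ c → (x - c) ^ (n + 1) * y x = v x) →
        ∀ x ∈ ball c ρ, x ≠ c → (x - c) ^ n * y x = dslope v c x := by
      intro v y hvc hyv x hx hxc
      have hxc' : x - c ≠ 0 := sub_ne_zero.mpr hxc
      rw [dslope_of_ne _ hxc, slope_def_field, hvc, ← hyv x hx hxc]
      field_simp
      ring
    have hnhds : ball c ρ ∈ 𝓝 c := isOpen_ball.mem_nhds hc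
    exact ih ((Complex.differentiableOn_dslope hnhds).mpr hv₁)
      ((Complex.differentiableOn_dslope hnhds).mpr hv₂) (hdiv hv₁c hyv₁) (hdiv hv₂c hyv₂)

attribute [local instance] Matrix.linftyOpNormedRing Matrix.linftyOpNormedAlgebra in
theorem exists_planar_fundamental_solution {p q r s : ℂ → ℂ} (hρ : 0 < ρ)
    (hp : DifferentiableOn ℂ p (ball c ρ)) (hq : DifferentiableOn ℂ q (ball c ρ))
    (hr : DifferentiableOn ℂ r (ball c ρ)) (hs : DifferentiableOn ℂ s (ball c ρ)) :
    ∃ y₁ y₂ : Fin 2 → ℂ → ℂ,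
      (∀ x ∈ ball c ρ, ∀ j, HasDerivAt (y₁ j) (p x * y₁ j x + q x * y₂ j x) x) ∧
      (∀ x ∈ ball c ρ, ∀ j, HasDerivAt (y₂ j) (r x * y₁ j x + s x * y₂ j x) x) ∧
      ∀ x ∈ ball c ρ, y₁ 0 x * y₂ 1 x - y₁ 1 x * y₂ 0 x ≠ 0 := by
  have hB : DifferentiableOn ℂ (fun x => p x • (!![1, 0; 0, 0] : Matrix (Fin 2) (Fin 2) ℂ) +
      q x • !![0, 1; 0, 0] + r x • !![0, 0; 1, 0] + s x • !![0, 0; 0, 1]) (ball c ρ) :=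
    (((hp.smul_const _).add (hq.smul_const _)).add (hr.smul_const _)).add (hs.smul_const _)
  obtain ⟨Y, hY0, hY⟩ := exists_linearODE_solution hB
  have hent : ∀ x ∈ ball c ρ, ∀ i j, HasDerivAt (fun z => Y z i j)
      (((p x • (!![1, 0; 0, 0] : Matrix (Fin 2) (Fin 2) ℂ) + q x • !![0, 1; 0, 0] +
        r x • !![0, 0; 1, 0] + s x • !![0, 0; 0, 1]) * Y x : Matrix (Fin 2) (Fin 2) ℂ) i j) x := by
    intro x hx i j
    exact (LinearMap.toContinuousLinearMap
      (Matrix.entryLinearMap ℂ ℂ i j)).hasFDerivAt.comp_hasDerivAt x (hY x hx)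
  have h₁ : ∀ x ∈ ball c ρ, ∀ j,
      HasDerivAt (fun z => Y z 0 j) (p x * Y x 0 j + q x * Y x 1 j) x := by
    intro x hx j
    simpa [Matrix.mul_apply, Fin.sum_univ_two] using hent x hx 0 j
  have h₂ : ∀ x ∈ ball c ρ, ∀ j,
      HasDerivAt (fun z => Y z 1 j) (r x * Y x 0 j + s x * Y x 1 j) x := by
    intro x hx j
    simpa [Matrix.mul_apply, Fin.sum_univ_two] using hent x hx 1 j
  refine ⟨fun j z => Y z 0 j, fun j z => Y z 1 j, h₁, h₂, fun x hx h0 => ?_⟩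
  have hd : ∀ z ∈ ball c ρ, HasDerivAt (fun z => Y z 0 0 * Y z 1 1 - Y z 0 1 * Y z 1 0)
      ((p z + s z) * (Y z 0 0 * Y z 1 1 - Y z 0 1 * Y z 1 0)) z := by
    intro z hz
    refine (((h₁ z hz 0).mul (h₂ z hz 1)).sub ((h₁ z hz 1).mul (h₂ z hz 0))).congr_deriv ?_
    ring
  have := (eq_zero_iff_of_deriv_eq_mul
    (fun z hz => (hd z hz).differentiableAt.differentiableWithinAt) (hp.add hs)
    (fun z hz _ => hd z hz) hx (mem_ball_self hρ)).mp h0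
  simp [hY0] at this

end Planar

theorem exists_differentiableOn_of_hasSum {c : ℂ} {ρ : ℝ} {a : ℕ → ℂ} {F : ℂ → ℂ}
    (h : ∀ x ∈ ball c ρ, x ≠ c → HasSum (fun k : ℕ => a k * (x - c) ^ k) (F x)) :
    ∃ f : ℂ → ℂ, DifferentiableOn ℂ f (ball c ρ) ∧ f c = a 0 ∧
      ∀ x ∈ ball c ρ, x ≠ c → F x = f x := by
  have hbd : ∀ r, 0 < r → r < ρ → ∃ C, ∀ k, ‖a k‖ * r ^ k ≤ C := by
    refine coeff_bound_of_summable fun r hr0 hr => ?_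
    have hz : c + (r : ℂ) ∈ ball c ρ := by simpa [abs_of_pos hr0] using hr
    have hzc : c + (r : ℂ) ≠ c := by simpa using hr0.ne'
    simpa [mul_comm] using (h _ hz hzc).summable
  refine ⟨fun x => ∑' k : ℕ, (x - c) ^ k • a k, fun x hx => ?_, ?_, fun x hx hxc => ?_⟩
  · have ht : ‖x - c‖ < ρ := by simpa [dist_eq_norm] using hx
    exact ((hasDerivAt_tsum_pow_smul hbd ht).comp_sub_const
      x c).differentiableAt.differentiableWithinAt
  · simp only [sub_self]
    rw [tsum_eq_single 0 (fun k hk => by simp [hk])]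
    simp
  · simpa [mul_comm] using (h x hx hxc).tsum_eq.symm

/- STATEMENT 7: For the 2×2 system with a₁₁, a₂₂ holomorphic across x₀,
   a₁₂ with a pole of order exactly 2 (leading coefficients γ₋₂ ≠ 0, γ₋₁) and
   a₂₁ holomorphic with a zero of order ≥ 2 at x₀, the system dW/dx = A(x)W has a
   strong regular fundamental solution at x₀ if and only if γ₋₂(α₀ − β₀) = γ₋₁. -/
theorem stmt_7 (x₀ : ℂ) (ρ₀ : ℝ) (hρ₀ : 0 < ρ₀)
    (D : Set ℂ) (hD : D = {x : ℂ | 0 < ‖x - x₀‖ ∧ ‖x - x₀‖ < ρ₀})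
    (A : ℂ → Matrix (Fin 2) (Fin 2) ℂ)
    (α β γ μ : ℕ → ℂ) (γm2 γm1 : ℂ) (hγm2 : γm2 ≠ 0)
    -- a₁₁(x) = α₀ + α₁(x−x₀) + …
    (hA11 : ∀ x ∈ D, HasSum (fun k : ℕ => α k * (x - x₀) ^ k) (A x 0 0))
    -- a₂₂(x) = β₀ + β₁(x−x₀) + …
    (hA22 : ∀ x ∈ D, HasSum (fun k : ℕ => β k * (x - x₀) ^ k) (A x 1 1))
    -- a₁₂(x) = γ₋₂(x−x₀)⁻² + γ₋₁(x−x₀)⁻¹ + γ₀ + …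
    (hA12 : ∀ x ∈ D, HasSum (fun k : ℕ => γ k * (x - x₀) ^ k)
      (A x 0 1 - γm2 * ((x - x₀) ^ (-2 : ℤ)) - γm1 * (x - x₀)⁻¹))
    -- a₂₁(x) = μ₂(x−x₀)² + μ₃(x−x₀)³ + …
    (hA21 : ∀ x ∈ D, HasSum (fun k : ℕ => μ k * (x - x₀) ^ (k + 2)) (A x 1 0)) :
    (∃ W : ℂ → Matrix (Fin 2) (Fin 2) ℂ,
      -- W solves dW/dx = A(x)W on D
      (∀ x ∈ D, ∀ i j, HasDerivAt (fun y => W y i j) ((A x * W x) i j) x) ∧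
      -- W is a fundamental solution
      (∀ x ∈ D, (W x).det ≠ 0) ∧
      -- strong regularity: (x−x₀)^{−m} W(x) extends holomorphically across x₀
      (∃ (m : ℤ) (V : ℂ → Matrix (Fin 2) (Fin 2) ℂ),
        (∀ i j, DifferentiableOn ℂ (fun x => V x i j) (Metric.ball x₀ ρ₀)) ∧
        ∀ x ∈ D, W x = ((x - x₀) ^ m) • V x)) ↔
    γm2 * (α 0 - β 0) = γm1 := by
  have hDmem : ∀ x, x ∈ D ↔ x ∈ ball x₀ ρ₀ ∧ x ≠ x₀ := by
    intro x
    rw [hD, mem_ofPred_eq, norm_pos_iff, sub_ne_zero, mem_ball, dist_eq_norm, and_comm]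
  obtain ⟨f, hf, hf0, hAf⟩ := exists_differentiableOn_of_hasSum (F := fun x => A x 0 0)
    fun x hx hxc => hA11 x ((hDmem x).mpr ⟨hx, hxc⟩)
  obtain ⟨g, hg, hg0, hAg⟩ := exists_differentiableOn_of_hasSum (F := fun x => A x 1 1)
    fun x hx hxc => hA22 x ((hDmem x).mpr ⟨hx, hxc⟩)
  obtain ⟨e, he, -, hAe⟩ := exists_differentiableOn_of_hasSum
    (F := fun x => A x 0 1 - γm2 * ((x - x₀) ^ (-2 : ℤ)) - γm1 * (x - x₀)⁻¹)
    fun x hx hxc => hA12 x ((hDmem x).mpr ⟨hx, hxc⟩)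
  obtain ⟨m, hm, -, hAm⟩ := exists_differentiableOn_of_hasSum (c := x₀) (ρ := ρ₀) (a := μ)
    (F := fun x => A x 1 0 / (x - x₀) ^ 2) (fun x hx hxc => by
      have hxc' : x - x₀ ≠ 0 := sub_ne_zero.mpr hxc
      have hsum := (hA21 x ((hDmem x).mpr ⟨hx, hxc⟩)).div_const ((x - x₀) ^ 2)
      have hfun : (fun k : ℕ => μ k * (x - x₀) ^ (k + 2) / (x - x₀) ^ 2) =
          fun k => μ k * (x - x₀) ^ k := by
        funext k
        rw [pow_add]
        field_simp
      rwa [hfun] at hsum)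
  have hx₀ : x₀ ∈ ball x₀ ρ₀ := mem_ball_self hρ₀
  have hnhds : ball x₀ ρ₀ ∈ 𝓝 x₀ := isOpen_ball.mem_nhds hx₀
  set h := dslope (fun x => f x - g x) x₀ with hh
  have hhd : DifferentiableOn ℂ h (ball x₀ ρ₀) :=
    (Complex.differentiableOn_dslope hnhds).mpr (hf.sub hg)
  have hfg : ∀ x, f x - g x = (α 0 - β 0) + (x - x₀) * h x := by
    intro x
    have := sub_smul_dslope (fun x => f x - g x) x₀ x
    rw [smul_eq_mul, hf0, hg0] at this
    rw [hh, this]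
    ring
  have h00 : ∀ x ∈ D, A x 0 0 = f x := fun x hx =>
    hAf x ((hDmem x).mp hx).1 ((hDmem x).mp hx).2
  have h11 : ∀ x ∈ D, A x 1 1 = g x := fun x hx =>
    hAg x ((hDmem x).mp hx).1 ((hDmem x).mp hx).2
  have hne : ∀ x ∈ D, x - x₀ ≠ 0 := fun x hx => sub_ne_zero.mpr ((hDmem x).mp hx).2
  have h01 : ∀ x ∈ D, A x 0 1 = γm2 / (x - x₀) ^ 2 + γm1 / (x - x₀) + e x := by
    intro x hx
    rw [← hAe x ((hDmem x).mp hx).1 ((hDmem x).mp hx).2, zpow_neg]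
    norm_cast
    ring
  have h10 : ∀ x ∈ D, A x 1 0 = (x - x₀) ^ 2 * m x := by
    intro x hx
    rw [← hAm x ((hDmem x).mp hx).1 ((hDmem x).mp hx).2]
    have := hne x hx
    field_simp
  have hid : DifferentiableOn ℂ (fun x => x - x₀) (ball x₀ ρ₀) := by fun_prop
  -- the gauge transformation `w₁ = γ₋₂ / (x - x₀) * y₁ + y₂`, `w₂ = -y₁` leads to a system
  -- with coefficients `p`, `q`, `κ / (x - x₀) + r`, `s`
  set κ : ℂ := γm2 * (α 0 - β 0) - γm1 with hκ
  set p : ℂ → ℂ := fun x => g x - γm2 * ((x - x₀) * m x) with hp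
  set q : ℂ → ℂ := fun x => -((x - x₀) ^ 2 * m x) with hq
  set r : ℂ → ℂ := fun x => γm2 * h x - e x + γm2 ^ 2 * m x with hr
  set s : ℂ → ℂ := fun x => f x + γm2 * ((x - x₀) * m x) with hs
  have hpd : DifferentiableOn ℂ p (ball x₀ ρ₀) := hg.sub ((hid.mul hm).const_mul γm2)
  have hqd : DifferentiableOn ℂ q (ball x₀ ρ₀) := ((hid.pow 2).mul hm).neg
  have hrd : DifferentiableOn ℂ r (ball x₀ ρ₀) :=
    ((hhd.const_mul γm2).sub he).add (hm.const_mul (γm2 ^ 2))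
  have hsd : DifferentiableOn ℂ s (ball x₀ ρ₀) := hf.add ((hid.mul hm).const_mul γm2)
  have hinv : ∀ x ∈ D, HasDerivAt (fun z => γm2 / (z - x₀)) (-γm2 / (x - x₀) ^ 2) x := by
    intro x hx
    simpa using (hasDerivAt_const x γm2).fun_div ((hasDerivAt_id x).sub_const x₀) (hne x hx)
  constructor
  · rintro ⟨W, hW, hdet, N, V, hV, hWV⟩
    by_contra hcon
    have hκ0 : κ ≠ 0 := sub_ne_zero.mpr hcon
    set y₁ : Fin 2 → ℂ → ℂ := fun j x => -W x 1 j with hy₁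
    set y₂ : Fin 2 → ℂ → ℂ := fun j x => W x 0 j + γm2 / (x - x₀) * W x 1 j with hy₂
    have hy₁d : ∀ j, ∀ x ∈ ball x₀ ρ₀, x ≠ x₀ →
        HasDerivAt (y₁ j) (p x * y₁ j x + q x * y₂ j x) x := by
      intro j x hx hxc
      have hxD := (hDmem x).mpr ⟨hx, hxc⟩
      have hxc' := hne x hxD
      refine (hW x hxD 1 j).neg.congr_deriv ?_
      rw [Matrix.mul_apply, Fin.sum_univ_two, h10 x hxD, h11 x hxD]
      simp only [hp, hq, hy₁, hy₂]
      field_simp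
      ring
    have hy₂d : ∀ j, ∀ x ∈ ball x₀ ρ₀, x ≠ x₀ →
        HasDerivAt (y₂ j) ((κ / (x - x₀) + r x) * y₁ j x + s x * y₂ j x) x := by
      intro j x hx hxc
      have hxD := (hDmem x).mpr ⟨hx, hxc⟩
      have hxc' := hne x hxD
      refine ((hW x hxD 0 j).add ((hinv x hxD).mul (hW x hxD 1 j))).congr_deriv ?_
      rw [Matrix.mul_apply, Matrix.mul_apply, Fin.sum_univ_two, Fin.sum_univ_two, h00 x hxD,
        h01 x hxD, h10 x hxD, h11 x hxD]
      have hf' : f x = g x + ((α 0 - β 0) + (x - x₀) * h x) := by rw [← hfg]; ring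
      simp only [hr, hs, hκ, hy₁, hy₂, hf']
      field_simp
      ring
    have hext : ∀ j, ∃ u₁ u₂ : ℂ → ℂ, DifferentiableOn ℂ u₁ (ball x₀ ρ₀) ∧
        DifferentiableOn ℂ u₂ (ball x₀ ρ₀) ∧
        (∀ x ∈ ball x₀ ρ₀, x ≠ x₀ → y₁ j x = u₁ x) ∧
        (∀ x ∈ ball x₀ ρ₀, x ≠ x₀ → y₂ j x = u₂ x) ∧ κ * u₁ x₀ = 0 := by
      intro j
      obtain ⟨n, k, hnk⟩ : ∃ n k : ℕ, (n : ℤ) + N = k + 1 :=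
        ⟨(1 - N).toNat, (N - 1).toNat, by omega⟩
      have hpow : ∀ x ∈ D, (x - x₀) ^ n * (x - x₀) ^ N = (x - x₀) ^ (k + 1) := by
        intro x hx
        rw [← zpow_natCast, ← zpow_add₀ (hne x hx), hnk]
        norm_cast
      refine exists_holomorphic_extension hρ₀ hpd hqd hrd hsd (hy₁d j) (hy₂d j) n
        (v₁ := fun x => -((x - x₀) ^ (k + 1) * V x 1 j))
        (v₂ := fun x => (x - x₀) ^ (k + 1) * V x 0 j + γm2 * ((x - x₀) ^ k * V x 1 j))
        ((hid.pow _).mul (hV 1 j)).neg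
        (((hid.pow _).mul (hV 0 j)).add (((hid.pow _).mul (hV 1 j)).const_mul γm2)) ?_ ?_
      · intro x hx hxc
        have hxD := (hDmem x).mpr ⟨hx, hxc⟩
        simp only [hy₁, hWV x hxD, Matrix.smul_apply, smul_eq_mul, ← hpow x hxD]
        ring
      · intro x hx hxc
        have hxD := (hDmem x).mpr ⟨hx, hxc⟩
        have hxc' := hne x hxD
        have hk : (x - x₀) ^ k = (x - x₀) ^ n * (x - x₀) ^ N / (x - x₀) := by
          rw [hpow x hxD, pow_succ]
          field_simp
        simp only [hy₂, hWV x hxD, Matrix.smul_apply, smul_eq_mul, ← hpow x hxD, hk]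
        ring
    choose u₁ u₂ hu₁ hu₂ hyu₁ hyu₂ hκu using hext
    have hu0 : ∀ j, u₁ j x₀ = 0 := fun j => (mul_eq_zero.mp (hκu j)).resolve_left hκ0
    have hu₁d : ∀ j, ∀ x ∈ ball x₀ ρ₀, x ≠ x₀ →
        HasDerivAt (u₁ j) (p x * u₁ j x + q x * u₂ j x) x := by
      intro j x hx hxc
      rw [← hyu₁ j x hx hxc, ← hyu₂ j x hx hxc]
      refine (hy₁d j x hx hxc).congr_of_eventuallyEq ?_
      filter_upwards [eventually_mem_punctured_ball hx hxc] with z hz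
      rw [hyu₁ j z hz.1 hz.2]
    have hu₂d : ∀ j, ∀ x ∈ ball x₀ ρ₀, x ≠ x₀ →
        HasDerivAt (u₂ j) ((κ / (x - x₀) + r x) * u₁ j x + s x * u₂ j x) x := by
      intro j x hx hxc
      rw [← hyu₁ j x hx hxc, ← hyu₂ j x hx hxc]
      refine (hy₂d j x hx hxc).congr_of_eventuallyEq ?_
      filter_upwards [eventually_mem_punctured_ball hx hxc] with z hz
      rw [hyu₂ j z hz.1 hz.2]
    obtain ⟨z, hz, hzc⟩ : ∃ z ∈ ball x₀ ρ₀, z ≠ x₀ := by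
      refine ⟨x₀ + ((ρ₀ / 2 : ℝ) : ℂ), ?_, ?_⟩
      · rw [mem_ball, dist_eq_norm, add_sub_cancel_left, Complex.norm_real,
          Real.norm_of_nonneg (by positivity)]
        linarith
      · rw [Ne, add_eq_left, Complex.ofReal_eq_zero]
        positivity
    have hzero : u₁ 0 z * u₂ 1 z - u₁ 1 z * u₂ 0 z = 0 := by
      refine (eq_zero_iff_of_deriv_eq_mul (((hu₁ 0).mul (hu₂ 1)).sub ((hu₁ 1).mul (hu₂ 0)))
        (hpd.add hsd) (fun x hx hxc => ?_) hz hx₀).mpr ?_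
      · refine (((hu₁d 0 x hx hxc).mul (hu₂d 1 x hx hxc)).sub
          ((hu₁d 1 x hx hxc).mul (hu₂d 0 x hx hxc))).congr_deriv ?_
        simp only [Pi.add_apply, Pi.sub_apply, Pi.mul_apply]
        ring
      · simp [hu0]
    apply hdet z ((hDmem z).mpr ⟨hz, hzc⟩)
    rw [← hyu₁ 0 z hz hzc, ← hyu₁ 1 z hz hzc, ← hyu₂ 0 z hz hzc, ← hyu₂ 1 z hz hzc] at hzero
    rw [Matrix.det_fin_two, ← hzero]
    simp only [hy₁, hy₂]
    ring
  · intro hcon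
    obtain ⟨y₁, y₂, hy₁, hy₂, hdet⟩ :=
      exists_planar_fundamental_solution hρ₀ hpd hqd hrd hsd
    have hy₁d : ∀ j, DifferentiableOn ℂ (y₁ j) (ball x₀ ρ₀) := fun j x hx =>
      (hy₁ x hx j).differentiableAt.differentiableWithinAt
    have hy₂d : ∀ j, DifferentiableOn ℂ (y₂ j) (ball x₀ ρ₀) := fun j x hx =>
      (hy₂ x hx j).differentiableAt.differentiableWithinAt
    refine ⟨fun x => Matrix.of ![fun j => γm2 / (x - x₀) * y₁ j x + y₂ j x, fun j => -y₁ j x],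
      fun x hxD => ?_, fun x hxD => ?_, -1,
      fun x => Matrix.of ![fun j => γm2 * y₁ j x + (x - x₀) * y₂ j x,
        fun j => -((x - x₀) * y₁ j x)], ?_, fun x hxD => ?_⟩
    · have hx := ((hDmem x).mp hxD).1
      have hxc' := hne x hxD
      rw [Fin.forall_fin_two]
      constructor <;> intro j
      · refine (((hinv x hxD).mul (hy₁ x hx j)).add (hy₂ x hx j)).congr_deriv ?_
        rw [Matrix.mul_apply, Fin.sum_univ_two, h00 x hxD, h01 x hxD]
        have hf' : f x = g x + ((α 0 - β 0) + (x - x₀) * h x) := by rw [← hfg]; ring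
        simp only [hp, hq, hr, hs, hf', ← hcon, Matrix.of_apply, Matrix.cons_val_zero,
          Matrix.cons_val_one]
        field_simp
        ring
      · refine (hy₁ x hx j).neg.congr_deriv ?_
        rw [Matrix.mul_apply, Fin.sum_univ_two, h10 x hxD, h11 x hxD]
        simp only [hp, hq, Matrix.of_apply, Matrix.cons_val_zero, Matrix.cons_val_one]
        field_simp
        ring
    · have hx := ((hDmem x).mp hxD).1
      rw [Matrix.det_fin_two]
      simp only [Matrix.of_apply, Matrix.cons_val_zero, Matrix.cons_val_one]
      convert hdet x hx using 1
      ring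
    · rw [Fin.forall_fin_two]
      exact ⟨fun j => ((hy₁d j).const_mul γm2).add (hid.mul (hy₂d j)),
        fun j => (hid.mul (hy₁d j)).neg⟩
    · have hxc' := hne x hxD
      ext i j
      fin_cases i <;> simp <;> field_simp
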